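/- arXiv:1406.4257 — 2 statements merged into one kernel-verified Lean document; each statement's English description precedes it below -/
import Mathlib

section
/- Continuous dependence for the 1-2 junction: let {φ^1,φ^2,φ^3, f̄^1, Φ̄^2_f, Φ̄^3_f} and {ψ^1,ψ^2,ψ^3, ḡ^1, Φ̄^2_g, Φ̄^3_g} be two sets of initial and boundary data for the 1-2 junction system (with the same flux limiter Φ, table of games, distribution coefficient a and horizon T), and let F = (f^1,f^2,f^3) and G = (g^1,g^2,g^3) be corresponding mild kinetic solutions across the 1-2 junction. Then there exists a constant C > 0 such that sup_{t∈[0,T]} Σ_{r=1}^3 Σ_{j=1}^n |g^r_j(t) − f^r_j(t)| ≤ C [ Σ_{r=1}^3 Σ_{j=1}^n |ψ^r_j − φ^r_j| + ∫_0^T ( |Φ̄^1_g(t) − Φ̄^1_f(t)| + Σ_{r=2}^3 |Φ̄^r_g(t) − Φ̄^r_f(t)| + Σ_{j=1}^n |ḡ^1_j(t) − f̄^1_j(t)| ) dt ], where Φ̄^1_f(t) = Φ(Σ_j f̄^1_j(t), Σ_j f^1_j(t)) and Φ̄^1_g(t) = Φ(Σ_j ḡ^1_j(t), Σ_j g^1_j(t)).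 -/
open Set

noncomputable def rhoF {n : ℕ} (f : Fin n → ℝ) : ℝ := ∑ j, f j

noncomputable def fluxF {n : ℕ} (v f : Fin n → ℝ) : ℝ := ∑ j, v j * f j

noncomputable def gainF {n : ℕ} (η0 : ℝ) (A : Fin n → Fin n → Fin n → ℝ → ℝ)
    (j : Fin n) (f : Fin n → ℝ) : ℝ :=
  η0 * rhoF f * ∑ h, ∑ k, A h k j (rhoF f) * f h * f k

noncomputable def lossF {n : ℕ} (η0 : ℝ) (f : Fin n → ℝ) : ℝ := η0 * (rhoF f) ^ 2

def admissibleF {n : ℕ} (f : Fin n → ℝ) : Prop :=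
  (∀ j, 0 ≤ f j ∧ f j ≤ 1) ∧ rhoF f ≤ 1

noncomputable def deltaC {n : ℕ} (j : Fin n) : ℝ := if (j : ℕ) = 0 then 0 else 1

def IsSpeedLattice {n : ℕ} (hn : 2 ≤ n) (v : Fin n → ℝ) : Prop :=
  StrictMono v ∧ v ⟨0, by omega⟩ = 0 ∧ v ⟨n - 1, by omega⟩ = 1

def IsFluxLimiter (Φ : ℝ → ℝ → ℝ) : Prop :=
  (∀ u ∈ Icc (0:ℝ) 1, ∀ w ∈ Icc (0:ℝ) 1, Φ u w ∈ Icc (0:ℝ) 1) ∧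
  (∀ u ∈ Icc (0:ℝ) 1, ∀ w ∈ Icc (0:ℝ) 1, 1 < u + w → Φ u w * u ≤ 1 - w) ∧
  (∃ K : ℝ, 0 < K ∧ ∀ u₁ ∈ Icc (0:ℝ) 1, ∀ w₁ ∈ Icc (0:ℝ) 1, ∀ u₂ ∈ Icc (0:ℝ) 1,
    ∀ w₂ ∈ Icc (0:ℝ) 1, |Φ u₂ w₂ - Φ u₁ w₁| ≤ K * (|u₂ - u₁| + |w₂ - w₁|))

def IsTableOfGames {n : ℕ} (A : Fin n → Fin n → Fin n → ℝ → ℝ) : Prop :=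
  (∀ h k j : Fin n, ∀ u ∈ Icc (0:ℝ) 1, A h k j u ∈ Icc (0:ℝ) 1) ∧
  (∀ h k : Fin n, ∀ u ∈ Icc (0:ℝ) 1, ∑ j, A h k j u = 1) ∧
  (∀ h k j : Fin n, ∃ K : ℝ, 0 < K ∧ ∀ u ∈ Icc (0:ℝ) 1, ∀ w ∈ Icc (0:ℝ) 1,
    |A h k j u - A h k j w| ≤ K * |u - w|)

noncomputable def rhs1 {n : ℕ} (v : Fin n → ℝ) (η0 : ℝ) (A : Fin n → Fin n → Fin n → ℝ → ℝ)
    (Φ : ℝ → ℝ → ℝ) (a : ℝ) (fbar1 f1 f2 f3 : ℝ → Fin n → ℝ) (j : Fin n) (s : ℝ) : ℝ :=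
  v j * (Φ (∑ k, fbar1 s k) (rhoF (f1 s)) * fbar1 s j
    - (a * Φ (a * ∑ k, deltaC k * f1 s k) (rhoF (f2 s))
      + (1 - a) * Φ ((1 - a) * ∑ k, deltaC k * f1 s k) (rhoF (f3 s))) * f1 s j)
  + gainF η0 A j (f1 s) - f1 s j * lossF η0 (f1 s)

noncomputable def rhs2 {n : ℕ} (v : Fin n → ℝ) (η0 : ℝ) (A : Fin n → Fin n → Fin n → ℝ → ℝ)
    (Φ : ℝ → ℝ → ℝ) (a : ℝ) (Φbar2 : ℝ → ℝ) (f1 f2 : ℝ → Fin n → ℝ) (j : Fin n) (s : ℝ) : ℝ :=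
  v j * (a * Φ (a * ∑ k, deltaC k * f1 s k) (rhoF (f2 s)) * f1 s j * deltaC j
    - Φbar2 s * f2 s j)
  + gainF η0 A j (f2 s) - f2 s j * lossF η0 (f2 s)

noncomputable def rhs3 {n : ℕ} (v : Fin n → ℝ) (η0 : ℝ) (A : Fin n → Fin n → Fin n → ℝ → ℝ)
    (Φ : ℝ → ℝ → ℝ) (a : ℝ) (Φbar3 : ℝ → ℝ) (f1 f3 : ℝ → Fin n → ℝ) (j : Fin n) (s : ℝ) : ℝ :=
  v j * ((1 - a) * Φ ((1 - a) * ∑ k, deltaC k * f1 s k) (rhoF (f3 s)) * f1 s j * deltaC j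
    - Φbar3 s * f3 s j)
  + gainF η0 A j (f3 s) - f3 s j * lossF η0 (f3 s)

def IsMildSol12 {n : ℕ} (v : Fin n → ℝ) (η0 : ℝ) (A : Fin n → Fin n → Fin n → ℝ → ℝ)
    (Φ : ℝ → ℝ → ℝ) (a T : ℝ) (φ1 φ2 φ3 : Fin n → ℝ)
    (fbar1 : ℝ → Fin n → ℝ) (Φbar2 Φbar3 : ℝ → ℝ) (f1 f2 f3 : ℝ → Fin n → ℝ) : Prop :=
  ContinuousOn f1 (Icc 0 T) ∧ ContinuousOn f2 (Icc 0 T) ∧ ContinuousOn f3 (Icc 0 T) ∧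
  (∀ t ∈ Icc (0:ℝ) T, admissibleF (f1 t) ∧ admissibleF (f2 t) ∧ admissibleF (f3 t)) ∧
  (∀ t ∈ Icc (0:ℝ) T, ∀ j : Fin n,
    f1 t j = φ1 j + ∫ s in (0:ℝ)..t, rhs1 v η0 A Φ a fbar1 f1 f2 f3 j s) ∧
  (∀ t ∈ Icc (0:ℝ) T, ∀ j : Fin n,
    f2 t j = φ2 j + ∫ s in (0:ℝ)..t, rhs2 v η0 A Φ a Φbar2 f1 f2 j s) ∧
  (∀ t ∈ Icc (0:ℝ) T, ∀ j : Fin n,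
    f3 t j = φ3 j + ∫ s in (0:ℝ)..t, rhs3 v η0 A Φ a Φbar3 f1 f3 j s)

def GoodData12 {n : ℕ} (T : ℝ) (φ1 φ2 φ3 : Fin n → ℝ) (fbar1 : ℝ → Fin n → ℝ)
    (Φbar2 Φbar3 : ℝ → ℝ) : Prop :=
  admissibleF φ1 ∧ admissibleF φ2 ∧ admissibleF φ3 ∧
  ContinuousOn fbar1 (Icc 0 T) ∧ (∀ t ∈ Icc (0:ℝ) T, admissibleF (fbar1 t)) ∧
  ContinuousOn Φbar2 (Icc 0 T) ∧ (∀ t ∈ Icc (0:ℝ) T, Φbar2 t ∈ Icc (0:ℝ) 1) ∧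
  ContinuousOn Φbar3 (Icc 0 T) ∧ (∀ t ∈ Icc (0:ℝ) T, Φbar3 t ∈ Icc (0:ℝ) 1)

/-- A real function that is bounded and Lipschitz on `S`, with a common constant. -/
def BddLipOn {X : Type*} [PseudoMetricSpace X] (S : Set X) (F : X → ℝ) : Prop :=
  ∃ K : ℝ, ∀ x ∈ S, |F x| ≤ K ∧ ∀ y ∈ S, |F x - F y| ≤ K * dist x y

namespace BddLipOn

variable {X : Type*} [PseudoMetricSpace X] {S : Set X} {F G : X → ℝ}

theorem const (c : ℝ) : BddLipOn S (fun _ => c) :=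
  ⟨|c|, fun x _ => ⟨le_rfl, fun y _ => by simpa using mul_nonneg (abs_nonneg c) dist_nonneg⟩⟩

theorem add (hF : BddLipOn S F) (hG : BddLipOn S G) : BddLipOn S (fun x => F x + G x) := by
  obtain ⟨K, hK⟩ := hF
  obtain ⟨L, hL⟩ := hG
  refine ⟨K + L, fun x hx => ⟨(abs_add_le _ _).trans (add_le_add (hK x hx).1 (hL x hx).1),
    fun y hy => ?_⟩⟩
  rw [add_sub_add_comm, add_mul]
  exact (abs_add_le _ _).trans (add_le_add ((hK x hx).2 y hy) ((hL x hx).2 y hy))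

theorem mul (hF : BddLipOn S F) (hG : BddLipOn S G) : BddLipOn S (fun x => F x * G x) := by
  obtain ⟨K, hK⟩ := hF
  obtain ⟨L, hL⟩ := hG
  refine ⟨2 * |K| * |L|, fun x hx => ⟨?_, fun y hy => ?_⟩⟩
  · have hF' : |F x| ≤ |K| := (hK x hx).1.trans (le_abs_self K)
    have hG' : |G x| ≤ |L| := (hL x hx).1.trans (le_abs_self L)
    rw [abs_mul]
    have hKL : 0 ≤ |K| * |L| := by positivity
    linarith [mul_le_mul hF' hG' (abs_nonneg _) (abs_nonneg _)]
  · have hd : 0 ≤ dist x y := dist_nonneg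
    have hF' : |F x| ≤ |K| := (hK x hx).1.trans (le_abs_self K)
    have hG' : |G y| ≤ |L| := (hL y hy).1.trans (le_abs_self L)
    have hFd : |F x - F y| ≤ |K| * dist x y :=
      ((hK x hx).2 y hy).trans (mul_le_mul_of_nonneg_right (le_abs_self K) hd)
    have hGd : |G x - G y| ≤ |L| * dist x y :=
      ((hL x hx).2 y hy).trans (mul_le_mul_of_nonneg_right (le_abs_self L) hd)
    calc |F x * G x - F y * G y| = |F x * (G x - G y) + (F x - F y) * G y| := by ring_nf
      _ ≤ |F x| * |G x - G y| + |F x - F y| * |G y| := by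
        rw [← abs_mul, ← abs_mul]; exact abs_add_le _ _
      _ ≤ |K| * (|L| * dist x y) + |K| * dist x y * |L| := by gcongr
      _ = 2 * |K| * |L| * dist x y := by ring

theorem sub (hF : BddLipOn S F) (hG : BddLipOn S G) : BddLipOn S (fun x => F x - G x) := by
  simpa [sub_eq_add_neg] using hF.add ((const (-1)).mul hG)

theorem sum {ι : Type*} (s : Finset ι) {F : ι → X → ℝ} (hF : ∀ i, BddLipOn S (F i)) :
    BddLipOn S (fun x => ∑ i ∈ s, F i x) := by
  classical
  induction s using Finset.induction_on with
  | empty => simpa using const 0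
  | insert i s hi ih => simpa [Finset.sum_insert hi] using (hF i).add ih

theorem comp₂ {Φ : ℝ → ℝ → ℝ} {I J : Set ℝ} {B K : ℝ} (hK : 0 ≤ K)
    (hB : ∀ u ∈ I, ∀ w ∈ J, |Φ u w| ≤ B)
    (hΦ : ∀ u₁ ∈ I, ∀ w₁ ∈ J, ∀ u₂ ∈ I, ∀ w₂ ∈ J,
      |Φ u₂ w₂ - Φ u₁ w₁| ≤ K * (|u₂ - u₁| + |w₂ - w₁|))
    (hF : BddLipOn S F) (hG : BddLipOn S G) (hFI : ∀ x ∈ S, F x ∈ I) (hGJ : ∀ x ∈ S, G x ∈ J) :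
    BddLipOn S (fun x => Φ (F x) (G x)) := by
  obtain ⟨M, hM⟩ := hF
  obtain ⟨L, hL⟩ := hG
  refine ⟨max B (K * (M + L)), fun x hx =>
    ⟨(hB _ (hFI x hx) _ (hGJ x hx)).trans (le_max_left _ _), fun y hy => ?_⟩⟩
  calc |Φ (F x) (G x) - Φ (F y) (G y)| ≤ K * (|F x - F y| + |G x - G y|) :=
        hΦ _ (hFI y hy) _ (hGJ y hy) _ (hFI x hx) _ (hGJ x hx)
    _ ≤ K * (M * dist x y + L * dist x y) := by
        gcongr
        exacts [(hM x hx).2 y hy, (hL x hx).2 y hy]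
    _ = K * (M + L) * dist x y := by ring
    _ ≤ _ := by gcongr; exact le_max_right _ _

theorem continuousOn (hF : BddLipOn S F) : ContinuousOn F S := by
  obtain ⟨K, hK⟩ := hF
  refine (LipschitzOnWith.of_dist_le_mul (K := K.toNNReal) fun x hx y hy => ?_).continuousOn
  rw [Real.dist_eq]
  exact ((hK x hx).2 y hy).trans
    (mul_le_mul_of_nonneg_right (Real.le_coe_toNNReal K) dist_nonneg)

end BddLipOn

/-- Grönwall's inequality in integral form, for a continuous nonnegative function. -/
theorem gronwall_integral {D : ℝ → ℝ} {T M N : ℝ} (hT : 0 ≤ T) (hM : 0 ≤ M) (hN : 0 ≤ N)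
    (hD : ContinuousOn D (Icc 0 T)) (hD0 : ∀ t ∈ Icc 0 T, 0 ≤ D t)
    (h : ∀ t ∈ Icc 0 T, D t ≤ M + N * ∫ s in (0:ℝ)..t, D s) :
    ∀ t ∈ Icc 0 T, D t ≤ M * Real.exp (N * t) := by
  set E : ℝ → ℝ := IccExtend hT ((Icc 0 T).domRestrict D) with hE
  have hEc : Continuous E := hD.domRestrict.Icc_extend'
  have hED : ∀ t ∈ Icc 0 T, E t = D t := fun t ht => IccExtend_of_mem hT _ ht
  have hint : ∀ t ∈ Icc 0 T, ∫ s in (0:ℝ)..t, D s = ∫ s in (0:ℝ)..t, E s := by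
    intro t ht
    refine intervalIntegral.integral_congr fun s hs => ?_
    rw [uIcc_of_le ht.1] at hs
    exact (hED s ⟨hs.1, hs.2.trans ht.2⟩).symm
  have hderiv : ∀ t, HasDerivAt (fun t => M + N * ∫ s in (0:ℝ)..t, E s) (N * E t) t := fun t =>
    ((hEc.integral_hasStrictDerivAt 0 t).hasDerivAt.const_mul N).const_add M
  have hpos : ∀ t ∈ Icc 0 T, 0 ≤ M + N * ∫ s in (0:ℝ)..t, E s := by
    intro t ht
    have := hint t ht ▸ intervalIntegral.integral_nonneg ht.1
      (fun s hs => hD0 s ⟨hs.1, hs.2.trans ht.2⟩)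
    positivity
  have key := norm_le_gronwallBound_of_norm_deriv_right_le (δ := M) (K := N) (ε := 0)
    (fun t _ => (hderiv t).continuousAt.continuousWithinAt)
    (fun t _ => (hderiv t).hasDerivWithinAt) (by simp [abs_of_nonneg hM])
    (a := 0) (b := T) (fun t ht => by
      have ht' : t ∈ Icc 0 T := ⟨ht.1, ht.2.le⟩
      rw [Real.norm_eq_abs, Real.norm_eq_abs, abs_of_nonneg (hpos t ht'), add_zero,
        abs_of_nonneg (mul_nonneg hN (hED t ht' ▸ hD0 t ht')), hED t ht']
      exact mul_le_mul_of_nonneg_left (hint t ht' ▸ h t ht') hN)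
  intro t ht
  have hk := key t ht
  rw [gronwallBound_ε0, sub_zero, Real.norm_eq_abs, abs_of_nonneg (hpos t ht)] at hk
  exact (hint t ht ▸ h t ht).trans hk

/-- Two integral representations whose integrands are `γ`-close differ by the initial gap plus
the integral of `γ`. -/
theorem abs_sub_le_of_integral_repr {u w p q γ : ℝ → ℝ} {u₀ w₀ T t : ℝ} (ht : t ∈ Icc 0 T)
    (hu : u t = u₀ + ∫ s in (0:ℝ)..t, p s) (hw : w t = w₀ + ∫ s in (0:ℝ)..t, q s)
    (hp : ContinuousOn p (Icc 0 T)) (hq : ContinuousOn q (Icc 0 T))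
    (hγ : ContinuousOn γ (Icc 0 T)) (hpq : ∀ s ∈ Icc 0 T, |p s - q s| ≤ γ s) :
    |u t - w t| ≤ |u₀ - w₀| + ∫ s in (0:ℝ)..t, γ s := by
  have hsub : Icc 0 t ⊆ Icc 0 T := Icc_subset_Icc_right ht.2
  have hi : ∀ {r : ℝ → ℝ}, ContinuousOn r (Icc 0 T) →
      IntervalIntegrable r MeasureTheory.volume 0 t := fun hr =>
    (hr.mono hsub).intervalIntegrable_of_Icc ht.1
  rw [hu, hw, add_sub_add_comm, ← intervalIntegral.integral_sub (hi hp) (hi hq)]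
  refine (abs_add_le _ _).trans (add_le_add le_rfl ?_)
  rw [← Real.norm_eq_abs]
  refine intervalIntegral.norm_integral_le_of_norm_le ht.1 (.of_forall fun s hs => ?_) (hi hγ)
  exact hpq s (hsub ⟨hs.1.le, hs.2⟩)

theorem BddLipOn.exists_forall_abs_sub_le {ι X : Type*} [Fintype ι] [PseudoMetricSpace X]
    {S : Set X} {R : ι → X → ℝ} (hR : ∀ i, BddLipOn S (R i)) :
    ∃ K : ℝ, 0 ≤ K ∧ ∀ i, ∀ x ∈ S, ∀ y ∈ S, |R i x - R i y| ≤ K * dist x y := by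
  choose K hK using hR
  refine ⟨∑ i, |K i|, Finset.sum_nonneg fun _ _ => abs_nonneg _, fun i x hx y hy => ?_⟩
  refine ((hK i x hx).2 y hy).trans (mul_le_mul_of_nonneg_right ?_ dist_nonneg)
  exact (le_abs_self _).trans
    (Finset.single_le_sum (f := fun i => |K i|) (fun _ _ => abs_nonneg _) (Finset.mem_univ i))

/-- Integral estimate for the `ℓ¹` distance of two families driven by a common bounded Lipschitz
field `R` along the curves `x`, `y` and by the source terms `b`, `c`. -/
theorem exists_sum_abs_sub_le_integral {ι X : Type*} [Fintype ι] [PseudoMetricSpace X]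
    {S : Set X} {R : ι → X → ℝ} (hR : ∀ i, BddLipOn S (R i)) {T : ℝ} {x y : ℝ → X}
    (hx : ContinuousOn x (Icc 0 T)) (hy : ContinuousOn y (Icc 0 T))
    (hxS : MapsTo x (Icc 0 T) S) (hyS : MapsTo y (Icc 0 T) S)
    {b c p q : ι → ℝ → ℝ} {β D : ℝ → ℝ}
    (hb : ∀ i, ContinuousOn (b i) (Icc 0 T)) (hc : ∀ i, ContinuousOn (c i) (Icc 0 T))
    (hβ : ContinuousOn β (Icc 0 T)) (hD : ContinuousOn D (Icc 0 T))
    (hβ0 : ∀ s ∈ Icc 0 T, 0 ≤ β s) (hxyD : ∀ s ∈ Icc 0 T, dist (x s) (y s) ≤ D s)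
    (hbc : ∀ i, ∀ s ∈ Icc 0 T, |b i s - c i s| ≤ β s + D s)
    (hp : ∀ i s, p i s = b i s + R i (x s)) (hq : ∀ i s, q i s = c i s + R i (y s))
    {u w : ℝ → ι → ℝ} {u₀ w₀ : ι → ℝ}
    (hu : ∀ t ∈ Icc 0 T, ∀ i, u t i = u₀ i + ∫ s in (0:ℝ)..t, p i s)
    (hw : ∀ t ∈ Icc 0 T, ∀ i, w t i = w₀ i + ∫ s in (0:ℝ)..t, q i s) :
    ∃ L : ℝ, 0 ≤ L ∧ ∀ t ∈ Icc 0 T,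
      ∑ i, |u t i - w t i| ≤ (∑ i, |u₀ i - w₀ i|) + L * ∫ s in (0:ℝ)..t, (β s + D s) := by
  obtain ⟨K, hK0, hK⟩ := BddLipOn.exists_forall_abs_sub_le hR
  refine ⟨Fintype.card ι * (1 + K), by positivity, fun t ht => ?_⟩
  have hi : ∀ i, |u t i - w t i| ≤
      |u₀ i - w₀ i| + (1 + K) * ∫ s in (0:ℝ)..t, (β s + D s) := by
    intro i
    rw [← intervalIntegral.integral_const_mul]
    refine abs_sub_le_of_integral_repr (u := fun t => u t i) (w := fun t => w t i)
      (γ := fun s => (1 + K) * (β s + D s)) ht (hu t ht i) (hw t ht i) ?_ ?_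
      (continuousOn_const.mul (hβ.add hD)) fun s hs => ?_
    · exact ((hb i).add ((hR i).continuousOn.comp hx hxS)).congr fun s _ => hp i s
    · exact ((hc i).add ((hR i).continuousOn.comp hy hyS)).congr fun s _ => hq i s
    · rw [hp, hq, add_sub_add_comm]
      refine (abs_add_le _ _).trans ?_
      have h₁ := (hK i _ (hxS hs) _ (hyS hs)).trans (mul_le_mul_of_nonneg_left (hxyD s hs) hK0)
      linarith [hbc i s hs, mul_nonneg hK0 (hβ0 s hs)]
  refine (Finset.sum_le_sum fun i _ => hi i).trans_eq ?_
  rw [Finset.sum_add_distrib, Finset.sum_const, Finset.card_univ, nsmul_eq_mul, mul_assoc]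

theorem abs_mul_mul_sub_mul_mul_le {v p q y z : ℝ} (hv : v ∈ Icc (0:ℝ) 1)
    (hp : p ∈ Icc (0:ℝ) 1) (hz : z ∈ Icc (0:ℝ) 1) :
    |v * (p * y) - v * (q * z)| ≤ |p - q| + |y - z| := by
  have h : v * (p * y) - v * (q * z) = v * (z * (p - q) + p * (y - z)) := by ring
  rw [h, abs_mul, abs_of_nonneg hv.1]
  refine (mul_le_of_le_one_left (abs_nonneg _) hv.2).trans ((abs_add_le _ _).trans ?_)
  rw [abs_mul, abs_mul, abs_of_nonneg hz.1, abs_of_nonneg hp.1]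
  exact add_le_add (mul_le_of_le_one_left (abs_nonneg _) hz.2)
    (mul_le_of_le_one_left (abs_nonneg _) hp.2)

/-- Admissible states of the three roads meeting at the junction. -/
def junctionStates (n : ℕ) : Set ((Fin n → ℝ) × (Fin n → ℝ) × (Fin n → ℝ)) :=
  {x | admissibleF x.1 ∧ admissibleF x.2.1 ∧ admissibleF x.2.2}

section Junction

variable {n : ℕ}

theorem admissibleF.rhoF_mem {f : Fin n → ℝ} (hf : admissibleF f) : rhoF f ∈ Icc (0:ℝ) 1 :=
  ⟨Finset.sum_nonneg fun j _ => (hf.1 j).1, hf.2⟩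

theorem deltaC_nonneg (j : Fin n) : 0 ≤ deltaC j := by unfold deltaC; split <;> norm_num

theorem deltaC_le_one (j : Fin n) : deltaC j ≤ 1 := by unfold deltaC; split <;> norm_num

theorem admissibleF.mul_sum_deltaC_mem {f : Fin n → ℝ} (hf : admissibleF f) {a : ℝ}
    (ha : a ∈ Icc (0:ℝ) 1) : a * ∑ k, deltaC k * f k ∈ Icc (0:ℝ) 1 := by
  have h0 : 0 ≤ ∑ k, deltaC k * f k :=
    Finset.sum_nonneg fun k _ => mul_nonneg (deltaC_nonneg k) (hf.1 k).1
  have h1 : ∑ k, deltaC k * f k ≤ 1 := (Finset.sum_le_sum fun k _ =>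
    mul_le_of_le_one_left (hf.1 k).1 (deltaC_le_one k)).trans hf.2
  exact ⟨mul_nonneg ha.1 h0, mul_le_one₀ ha.2 h0 h1⟩

theorem IsSpeedLattice.mem_Icc {hn : 2 ≤ n} {v : Fin n → ℝ} (hv : IsSpeedLattice hn v)
    (j : Fin n) : v j ∈ Icc (0:ℝ) 1 := by
  obtain ⟨hmono, h0, h1⟩ := hv
  constructor
  · rw [← h0]; exact hmono.monotone (Fin.mk_le_of_le_val (Nat.zero_le _))
  · rw [← h1]; exact hmono.monotone (Fin.le_def.2 (by have := j.2; simp; omega))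

variable {X : Type*} [PseudoMetricSpace X] {S : Set X} {F G : X → Fin n → ℝ}

theorem IsFluxLimiter.bddLipOn_comp {Φ : ℝ → ℝ → ℝ} (hΦ : IsFluxLimiter Φ) {p q : X → ℝ}
    (hp : BddLipOn S p) (hq : BddLipOn S q) (hp' : ∀ x ∈ S, p x ∈ Icc (0:ℝ) 1)
    (hq' : ∀ x ∈ S, q x ∈ Icc (0:ℝ) 1) : BddLipOn S (fun x => Φ (p x) (q x)) := by
  obtain ⟨hb, -, K, hK, hlip⟩ := hΦ
  refine BddLipOn.comp₂ (B := 1) hK.le (fun u hu w hw => ?_) hlip hp hq hp' hq'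
  rw [abs_of_nonneg (hb u hu w hw).1]
  exact (hb u hu w hw).2

theorem IsFluxLimiter.continuousOn {Φ : ℝ → ℝ → ℝ} (hΦ : IsFluxLimiter Φ) :
    ContinuousOn (fun p : ℝ × ℝ => Φ p.1 p.2) (Icc (0:ℝ) 1 ×ˢ Icc (0:ℝ) 1) := by
  have habs : ∀ u ∈ Icc (0:ℝ) 1, |u| ≤ 1 := fun u hu => by rw [abs_of_nonneg hu.1]; exact hu.2
  refine (hΦ.bddLipOn_comp (p := Prod.fst) (q := Prod.snd)
    ⟨1, fun x hx => ⟨habs _ hx.1, fun y _ => ?_⟩⟩ ⟨1, fun x hx => ⟨habs _ hx.2, fun y _ => ?_⟩⟩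
    (fun x hx => hx.1) (fun x hx => hx.2)).continuousOn
  · rw [one_mul]; exact le_max_left _ _
  · rw [one_mul]; exact le_max_right _ _

theorem bddLipOn_interaction {A : Fin n → Fin n → Fin n → ℝ → ℝ} (hA : IsTableOfGames A)
    (η0 : ℝ) (hF : ∀ j, BddLipOn S (fun x => F x j)) (hFS : ∀ x ∈ S, admissibleF (F x))
    (j : Fin n) : BddLipOn S (fun x => gainF η0 A j (F x) - F x j * lossF η0 (F x)) := by
  have hρ : BddLipOn S (fun x => rhoF (F x)) := BddLipOn.sum _ hF
  have hAj : ∀ h k, BddLipOn S (fun x => A h k j (rhoF (F x))) := by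
    intro h k
    obtain ⟨K, hK, hlip⟩ := hA.2.2 h k j
    refine BddLipOn.comp₂ (Φ := fun u _ => A h k j u) (I := Icc 0 1) (J := Icc 0 1) (B := 1) hK.le
      (fun u hu _ _ => ?_) (fun u₁ hu₁ w₁ _ u₂ hu₂ w₂ _ => ?_) hρ hρ
      (fun x hx => (hFS x hx).rhoF_mem) (fun x hx => (hFS x hx).rhoF_mem)
    · rw [abs_of_nonneg (hA.1 h k j u hu).1]
      exact (hA.1 h k j u hu).2
    · refine (hlip u₂ hu₂ u₁ hu₁).trans (mul_le_mul_of_nonneg_left ?_ hK.le)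
      linarith [abs_nonneg (w₂ - w₁)]
  refine (((BddLipOn.const η0).mul hρ).mul (BddLipOn.sum _ fun h => BddLipOn.sum _ fun k =>
    ((hAj h k).mul (hF h)).mul (hF k))).sub ((hF j).mul ((BddLipOn.const η0).mul ?_))
  simpa only [pow_two] using hρ.mul hρ

theorem IsFluxLimiter.bddLipOn_junction {Φ : ℝ → ℝ → ℝ} (hΦ : IsFluxLimiter Φ) {a : ℝ}
    (ha : a ∈ Icc (0:ℝ) 1) (hF : ∀ j, BddLipOn S (fun x => F x j))
    (hG : ∀ j, BddLipOn S (fun x => G x j)) (hFS : ∀ x ∈ S, admissibleF (F x))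
    (hGS : ∀ x ∈ S, admissibleF (G x)) :
    BddLipOn S (fun x => a * Φ (a * ∑ k, deltaC k * F x k) (rhoF (G x))) :=
  (BddLipOn.const a).mul (hΦ.bddLipOn_comp
    ((BddLipOn.const a).mul (BddLipOn.sum _ fun k => (BddLipOn.const _).mul (hF k)))
    (BddLipOn.sum _ hG) (fun x hx => (hFS x hx).mul_sum_deltaC_mem ha)
    (fun x hx => (hGS x hx).rhoF_mem))

theorem bddLipOn_apply_of_dist_le (hd : ∀ x y, dist (F x) (F y) ≤ dist x y)
    (hFS : ∀ x ∈ S, admissibleF (F x)) (j : Fin n) : BddLipOn S (fun x => F x j) := by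
  refine ⟨1, fun x hx => ⟨?_, fun y _ => ?_⟩⟩
  · rw [abs_of_nonneg ((hFS x hx).1 j).1]
    exact ((hFS x hx).1 j).2
  · rw [one_mul, ← Real.dist_eq]
    exact (dist_le_pi_dist _ _ j).trans (hd x y)

theorem dist_le_sum_abs (f g : Fin n → ℝ) : dist f g ≤ ∑ j, |f j - g j| :=
  (dist_pi_le_iff (Finset.sum_nonneg fun _ _ => abs_nonneg _)).2 fun j => by
    rw [Real.dist_eq]
    exact Finset.single_le_sum (f := fun j => |f j - g j|) (fun _ _ => abs_nonneg _)
      (Finset.mem_univ j)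

theorem dist_triple_le_sum_abs (f₁ f₂ f₃ g₁ g₂ g₃ : Fin n → ℝ) :
    dist (f₁, f₂, f₃) (g₁, g₂, g₃) ≤
      (∑ j, |f₁ j - g₁ j|) + (∑ j, |f₂ j - g₂ j|) + ∑ j, |f₃ j - g₃ j| := by
  have h₁ := dist_le_sum_abs f₁ g₁
  have h₂ := dist_le_sum_abs f₂ g₂
  have h₃ := dist_le_sum_abs f₃ g₃
  have p₁ : 0 ≤ dist f₁ g₁ := dist_nonneg
  have p₂ : 0 ≤ dist f₂ g₂ := dist_nonneg
  have p₃ : 0 ≤ dist f₃ g₃ := dist_nonneg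
  rw [Prod.dist_eq, Prod.dist_eq]
  exact max_le (by linarith) (max_le (by linarith) (by linarith))

end Junction

/-- Continuous dependence for the 1-2 junction (Theorem 4.2 of the paper). -/
theorem continuous_dependence_one_two_junction
    {n : ℕ} (hn : 2 ≤ n) (v : Fin n → ℝ) (hv : IsSpeedLattice hn v)
    (η0 : ℝ) (hη0 : 0 < η0)
    (A : Fin n → Fin n → Fin n → ℝ → ℝ) (hA : IsTableOfGames A)
    (Φ : ℝ → ℝ → ℝ) (hΦ : IsFluxLimiter Φ)
    (a T : ℝ) (ha : a ∈ Icc (0:ℝ) 1) (hT : 0 < T)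
    (φ1 φ2 φ3 ψ1 ψ2 ψ3 : Fin n → ℝ)
    (fbar1 gbar1 : ℝ → Fin n → ℝ) (Φbar2f Φbar3f Φbar2g Φbar3g : ℝ → ℝ)
    (hdataf : GoodData12 T φ1 φ2 φ3 fbar1 Φbar2f Φbar3f)
    (hdatag : GoodData12 T ψ1 ψ2 ψ3 gbar1 Φbar2g Φbar3g)
    (f1 f2 f3 g1 g2 g3 : ℝ → Fin n → ℝ)
    (hF : IsMildSol12 v η0 A Φ a T φ1 φ2 φ3 fbar1 Φbar2f Φbar3f f1 f2 f3)
    (hG : IsMildSol12 v η0 A Φ a T ψ1 ψ2 ψ3 gbar1 Φbar2g Φbar3g g1 g2 g3) :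
    ∃ C : ℝ, 0 < C ∧ ∀ t ∈ Icc (0:ℝ) T,
      (∑ j, |g1 t j - f1 t j|) + (∑ j, |g2 t j - f2 t j|) + (∑ j, |g3 t j - f3 t j|)
        ≤ C * ((∑ j, |ψ1 j - φ1 j|) + (∑ j, |ψ2 j - φ2 j|) + (∑ j, |ψ3 j - φ3 j|)
          + ∫ s in (0:ℝ)..T,
              (|Φ (∑ k, gbar1 s k) (rhoF (g1 s)) - Φ (∑ k, fbar1 s k) (rhoF (f1 s))|
                + |Φbar2g s - Φbar2f s| + |Φbar3g s - Φbar3f s|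
                + ∑ j, |gbar1 s j - fbar1 s j|)) := by
  have hv' := hv.mem_Icc
  have ha' : 1 - a ∈ Icc (0:ℝ) 1 := ⟨by linarith [ha.2], by linarith [ha.1]⟩
  obtain ⟨-, -, -, hfbc, hfb, hf2c, hf2, hf3c, hf3⟩ := hdataf
  obtain ⟨-, -, -, hgbc, hgb, hg2c, hg2, hg3c, hg3⟩ := hdatag
  obtain ⟨cf1, cf2, cf3, Sf, If1, If2, If3⟩ := hF
  obtain ⟨cg1, cg2, cg3, Sg, Ig1, Ig2, Ig3⟩ := hG
  have single : ∀ (u w : Fin n → ℝ) (j : Fin n), |u j - w j| ≤ ∑ k, |u k - w k| := fun u w j =>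
    Finset.single_le_sum (f := fun k => |u k - w k|) (fun _ _ => abs_nonneg _)
      (Finset.mem_univ j)
  have sum0 : ∀ u w : Fin n → ℝ, 0 ≤ ∑ k, |u k - w k| := fun u w =>
    Finset.sum_nonneg fun _ _ => abs_nonneg _
  have comp : ∀ {f : ℝ → Fin n → ℝ}, ContinuousOn f (Icc 0 T) →
      ∀ j, ContinuousOn (fun s => f s j) (Icc 0 T) := fun hf j => continuousOn_pi.1 hf j
  have csum : ∀ {f g : ℝ → Fin n → ℝ}, ContinuousOn f (Icc 0 T) → ContinuousOn g (Icc 0 T) →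
      ContinuousOn (fun s => ∑ j, |g s j - f s j|) (Icc 0 T) := fun hf hg =>
    continuousOn_finsetSum _ fun j _ => ((comp hg j).sub (comp hf j)).abs
  have crho : ∀ {f : ℝ → Fin n → ℝ}, ContinuousOn f (Icc 0 T) →
      ContinuousOn (fun s => ∑ j, f s j) (Icc 0 T) := fun hf =>
    continuousOn_finsetSum _ fun j _ => comp hf j
  have cΦ : ∀ {f g : ℝ → Fin n → ℝ}, ContinuousOn f (Icc 0 T) → ContinuousOn g (Icc 0 T) →
      (∀ s ∈ Icc 0 T, admissibleF (f s)) → (∀ s ∈ Icc 0 T, admissibleF (g s)) →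
      ContinuousOn (fun s => Φ (∑ k, f s k) (rhoF (g s))) (Icc 0 T) := fun hf hg hfa hga =>
    hΦ.continuousOn.comp (f := fun s => (∑ k, _, rhoF _)) ((crho hf).prodMk (crho hg))
      fun s hs => ⟨(hfa s hs).rhoF_mem, (hga s hs).rhoF_mem⟩
  have cΦf := cΦ hfbc cf1 hfb fun s hs => (Sf s hs).1
  have cΦg := cΦ hgbc cg1 hgb fun s hs => (Sg s hs).1
  set β : ℝ → ℝ := fun s =>
    |Φ (∑ k, gbar1 s k) (rhoF (g1 s)) - Φ (∑ k, fbar1 s k) (rhoF (f1 s))|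
      + |Φbar2g s - Φbar2f s| + |Φbar3g s - Φbar3f s| + ∑ j, |gbar1 s j - fbar1 s j| with hβ
  set D : ℝ → ℝ := fun s =>
    (∑ j, |g1 s j - f1 s j|) + (∑ j, |g2 s j - f2 s j|) + (∑ j, |g3 s j - f3 s j|) with hD
  have cβ : ContinuousOn β (Icc 0 T) :=
    (((cΦg.sub cΦf).abs.add (hg2c.sub hf2c).abs).add (hg3c.sub hf3c).abs).add (csum hfbc hgbc)
  have cD : ContinuousOn D (Icc 0 T) := ((csum cf1 cg1).add (csum cf2 cg2)).add (csum cf3 cg3)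
  have hβ0 : ∀ s, 0 ≤ β s := fun s => by have := sum0 (gbar1 s) (fbar1 s); positivity
  have hD0 : ∀ s, 0 ≤ D s := fun s => by
    have := sum0 (g1 s) (f1 s)
    have := sum0 (g2 s) (f2 s)
    have := sum0 (g3 s) (f3 s)
    positivity
  have cx : ContinuousOn (fun s => (g1 s, g2 s, g3 s)) (Icc 0 T) := cg1.prodMk (cg2.prodMk cg3)
  have cy : ContinuousOn (fun s => (f1 s, f2 s, f3 s)) (Icc 0 T) := cf1.prodMk (cf2.prodMk cf3)
  have hxy : ∀ s, dist (g1 s, g2 s, g3 s) (f1 s, f2 s, f3 s) ≤ D s := fun s =>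
    dist_triple_le_sum_abs _ _ _ _ _ _
  have B1 : ∀ j, BddLipOn (junctionStates n) (fun x => x.1 j) :=
    bddLipOn_apply_of_dist_le (F := fun x : (Fin n → ℝ) × (Fin n → ℝ) × (Fin n → ℝ) => x.1)
      (fun x y => le_max_left _ _) fun x hx => hx.1
  have B2 : ∀ j, BddLipOn (junctionStates n) (fun x => x.2.1 j) :=
    bddLipOn_apply_of_dist_le (F := fun x : (Fin n → ℝ) × (Fin n → ℝ) × (Fin n → ℝ) => x.2.1)
      (fun x y => (le_max_left _ _).trans (le_max_right _ _)) fun x hx => hx.2.1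
  have B3 : ∀ j, BddLipOn (junctionStates n) (fun x => x.2.2 j) :=
    bddLipOn_apply_of_dist_le (F := fun x : (Fin n → ℝ) × (Fin n → ℝ) × (Fin n → ℝ) => x.2.2)
      (fun x y => (le_max_right _ _).trans (le_max_right _ _)) fun x hx => hx.2.2
  have J2 := hΦ.bddLipOn_junction ha B1 B2 (fun x hx => hx.1) (fun x hx => hx.2.1)
  have J3 := hΦ.bddLipOn_junction ha' B1 B3 (fun x hx => hx.1) (fun x hx => hx.2.2)
  have Q1 := bddLipOn_interaction hA η0 B1 (fun x hx => hx.1)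
  have Q2 := bddLipOn_interaction hA η0 B2 (fun x hx => hx.2.1)
  have Q3 := bddLipOn_interaction hA η0 B3 (fun x hx => hx.2.2)
  obtain ⟨L1, hL1, E1⟩ := exists_sum_abs_sub_le_integral
    (fun j => (Q1 j).sub (((BddLipOn.const (v j)).mul ((J2.add J3).mul (B1 j)))))
    cx cy Sg Sf
    (b := fun j s => v j * (Φ (∑ k, gbar1 s k) (rhoF (g1 s)) * gbar1 s j))
    (c := fun j s => v j * (Φ (∑ k, fbar1 s k) (rhoF (f1 s)) * fbar1 s j))
    (fun j => continuousOn_const.mul (cΦg.mul (comp hgbc j)))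
    (fun j => continuousOn_const.mul (cΦf.mul (comp hfbc j)))
    cβ cD (fun s _ => hβ0 s) (fun s _ => hxy s)
    (fun j s hs => by
      refine (abs_mul_mul_sub_mul_mul_le (hv' j) (hΦ.1 (∑ k, gbar1 s k)
        (hgb s hs).rhoF_mem _ (Sg s hs).1.rhoF_mem) ((hfb s hs).1 j)).trans ?_
      have := single (gbar1 s) (fbar1 s) j
      simp only [hβ]
      linarith [hD0 s, abs_nonneg (Φbar2g s - Φbar2f s), abs_nonneg (Φbar3g s - Φbar3f s)])
    (fun j s => by simp only [rhs1]; ring) (fun j s => by simp only [rhs1]; ring) Ig1 If1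
  obtain ⟨L2, hL2, E2⟩ := exists_sum_abs_sub_le_integral
    (fun j => (Q2 j).add ((BddLipOn.const (v j)).mul ((J2.mul (B1 j)).mul
      (BddLipOn.const (deltaC j)))))
    cx cy Sg Sf
    (b := fun j s => -(v j * (Φbar2g s * g2 s j)))
    (c := fun j s => -(v j * (Φbar2f s * f2 s j)))
    (fun j => (continuousOn_const.mul (hg2c.mul (comp cg2 j))).neg)
    (fun j => (continuousOn_const.mul (hf2c.mul (comp cf2 j))).neg)
    cβ cD (fun s _ => hβ0 s) (fun s _ => hxy s)
    (fun j s hs => by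
      rw [← neg_sub', abs_neg]
      refine (abs_mul_mul_sub_mul_mul_le (hv' j) (hg2 s hs) ((Sf s hs).2.1.1 j)).trans ?_
      simp only [hβ, hD]
      linarith [single (g2 s) (f2 s) j, sum0 (g1 s) (f1 s), sum0 (g3 s) (f3 s),
        sum0 (gbar1 s) (fbar1 s), abs_nonneg (Φbar3g s - Φbar3f s),
        abs_nonneg (Φ (∑ k, gbar1 s k) (rhoF (g1 s)) - Φ (∑ k, fbar1 s k) (rhoF (f1 s)))])
    (fun j s => by simp only [rhs2]; ring) (fun j s => by simp only [rhs2]; ring) Ig2 If2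
  obtain ⟨L3, hL3, E3⟩ := exists_sum_abs_sub_le_integral
    (fun j => (Q3 j).add ((BddLipOn.const (v j)).mul ((J3.mul (B1 j)).mul
      (BddLipOn.const (deltaC j)))))
    cx cy Sg Sf
    (b := fun j s => -(v j * (Φbar3g s * g3 s j)))
    (c := fun j s => -(v j * (Φbar3f s * f3 s j)))
    (fun j => (continuousOn_const.mul (hg3c.mul (comp cg3 j))).neg)
    (fun j => (continuousOn_const.mul (hf3c.mul (comp cf3 j))).neg)
    cβ cD (fun s _ => hβ0 s) (fun s _ => hxy s)
    (fun j s hs => by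
      rw [← neg_sub', abs_neg]
      refine (abs_mul_mul_sub_mul_mul_le (hv' j) (hg3 s hs) ((Sf s hs).2.2.1 j)).trans ?_
      simp only [hβ, hD]
      linarith [single (g3 s) (f3 s) j, sum0 (g1 s) (f1 s), sum0 (g2 s) (f2 s),
        sum0 (gbar1 s) (fbar1 s), abs_nonneg (Φbar2g s - Φbar2f s),
        abs_nonneg (Φ (∑ k, gbar1 s k) (rhoF (g1 s)) - Φ (∑ k, fbar1 s k) (rhoF (f1 s)))])
    (fun j s => by simp only [rhs3]; ring) (fun j s => by simp only [rhs3]; ring) Ig3 If3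
  have hN : 0 ≤ L1 + L2 + L3 := by positivity
  set I₀ := (∑ j, |ψ1 j - φ1 j|) + (∑ j, |ψ2 j - φ2 j|) + (∑ j, |ψ3 j - φ3 j|) with hI
  have hI0 : 0 ≤ I₀ := by
    linarith [sum0 ψ1 φ1, sum0 ψ2 φ2, sum0 ψ3 φ3]
  have hβT : 0 ≤ ∫ s in (0:ℝ)..T, β s :=
    intervalIntegral.integral_nonneg hT.le fun s _ => hβ0 s
  have hM : 0 ≤ I₀ + (L1 + L2 + L3) * ∫ s in (0:ℝ)..T, β s := by positivity
  have hint : ∀ t ∈ Icc 0 T, D t ≤ (I₀ + (L1 + L2 + L3) * ∫ s in (0:ℝ)..T, β s)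
      + (L1 + L2 + L3) * ∫ s in (0:ℝ)..t, D s := by
    intro t ht
    have hsub : Icc 0 t ⊆ Icc 0 T := Icc_subset_Icc_right ht.2
    have hsplit : ∫ s in (0:ℝ)..t, (β s + D s) =
        (∫ s in (0:ℝ)..t, β s) + ∫ s in (0:ℝ)..t, D s :=
      intervalIntegral.integral_add ((cβ.mono hsub).intervalIntegrable_of_Icc ht.1)
        ((cD.mono hsub).intervalIntegrable_of_Icc ht.1)
    have hmono : ∫ s in (0:ℝ)..t, β s ≤ ∫ s in (0:ℝ)..T, β s :=
      intervalIntegral.integral_mono_interval le_rfl ht.1 ht.2 (.of_forall hβ0)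
        (cβ.intervalIntegrable_of_Icc hT.le)
    have h1 := E1 t ht
    have h2 := E2 t ht
    have h3 := E3 t ht
    have h4 := mul_le_mul_of_nonneg_left hmono hN
    rw [hsplit] at h1 h2 h3
    calc D t ≤ _ := add_le_add (add_le_add h1 h2) h3
      _ ≤ _ := by linarith
  have key := gronwall_integral hT.le hM hN cD (fun t _ => hD0 t) hint
  refine ⟨(1 + (L1 + L2 + L3)) * Real.exp ((L1 + L2 + L3) * T), by positivity, fun t ht => ?_⟩
  refine (key t ht).trans ?_
  have hexp : Real.exp ((L1 + L2 + L3) * t) ≤ Real.exp ((L1 + L2 + L3) * T) :=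
    Real.exp_le_exp.2 (mul_le_mul_of_nonneg_left ht.2 hN)
  rw [mul_right_comm]
  refine mul_le_mul ?_ hexp (Real.exp_pos _).le (by positivity)
  linarith [mul_nonneg hN hI0]
end

section
/- Uniqueness for the 1-2 junction: for a given set of initial data φ^1, φ^2, φ^3 ∈ B and boundary data f̄^1 : [0,T] → B, Φ̄^2, Φ̄^3 : [0,T] → [0,1], there is at most one mild kinetic solution across the 1-2 junction; i.e., if F = (f^1,f^2,f^3) and G = (g^1,g^2,g^3) are both mild kinetic solutions with the same data, then f^r_j(t) = g^r_j(t) for all r = 1,2,3, j = 1,...,n and t ∈ [0,T]. -/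
open Set

/-- A time-dependent real function on a set `S`, regular enough to be a component of the vector
field of a Cauchy problem on `[0, T]`: bounded, Lipschitz in space uniformly in time, and jointly
continuous. -/
structure IsRegularField {E : Type*} [NormedAddCommGroup E] (T : ℝ) (S : Set E)
    (F : ℝ → E → ℝ) : Prop where
  bounded : ∃ C : ℝ, 0 ≤ C ∧ ∀ t ∈ Icc (0:ℝ) T, ∀ x ∈ S, |F t x| ≤ C
  lipschitz : ∃ K : ℝ, 0 ≤ K ∧ ∀ t ∈ Icc (0:ℝ) T, ∀ x ∈ S, ∀ y ∈ S,
    |F t x - F t y| ≤ K * ‖x - y‖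
  continuousOn : ContinuousOn (fun p : ℝ × E => F p.1 p.2) (Icc 0 T ×ˢ S)

namespace IsRegularField

variable {E : Type*} [NormedAddCommGroup E] {T : ℝ} {S : Set E} {F G : ℝ → E → ℝ}

theorem of_time {g : ℝ → ℝ} (hg : ContinuousOn g (Icc 0 T)) :
    IsRegularField T S (fun t _ => g t) where
  bounded := by
    obtain ⟨C, hC⟩ := isCompact_Icc.exists_bound_of_continuousOn hg
    exact ⟨max C 0, le_max_right _ _, fun t ht _ _ => (hC t ht).trans (le_max_left _ _)⟩
  lipschitz := ⟨0, le_rfl, fun t _ x _ y _ => by simp⟩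
  continuousOn := hg.comp continuousOn_fst fun _ hp => hp.1

theorem const (c : ℝ) : IsRegularField T S (fun _ _ => c) :=
  of_time continuousOn_const

theorem of_clm [NormedSpace ℝ E] (L : E →L[ℝ] ℝ) {C : ℝ} (hC : 0 ≤ C) (h : ∀ x ∈ S, |L x| ≤ C) :
    IsRegularField T S (fun _ x => L x) where
  bounded := ⟨C, hC, fun _ _ => h⟩
  lipschitz := ⟨‖L‖, norm_nonneg _, fun t _ x _ y _ => by
    rw [← map_sub]; exact L.le_opNorm _⟩
  continuousOn := (L.continuous.comp continuous_snd).continuousOn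

theorem add (hF : IsRegularField T S F) (hG : IsRegularField T S G) :
    IsRegularField T S (fun t x => F t x + G t x) where
  bounded := by
    obtain ⟨C, hC, h⟩ := hF.bounded
    obtain ⟨C', hC', h'⟩ := hG.bounded
    exact ⟨C + C', by positivity, fun t ht x hx =>
      (abs_add_le _ _).trans (add_le_add (h t ht x hx) (h' t ht x hx))⟩
  lipschitz := by
    obtain ⟨K, hK, h⟩ := hF.lipschitz
    obtain ⟨K', hK', h'⟩ := hG.lipschitz
    refine ⟨K + K', by positivity, fun t ht x hx y hy => ?_⟩
    rw [add_sub_add_comm, add_mul]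
    exact (abs_add_le _ _).trans (add_le_add (h t ht x hx y hy) (h' t ht x hx y hy))
  continuousOn := hF.continuousOn.add hG.continuousOn

theorem mul (hF : IsRegularField T S F) (hG : IsRegularField T S G) :
    IsRegularField T S (fun t x => F t x * G t x) where
  bounded := by
    obtain ⟨C, hC, h⟩ := hF.bounded
    obtain ⟨C', hC', h'⟩ := hG.bounded
    refine ⟨C * C', by positivity, fun t ht x hx => ?_⟩
    rw [abs_mul]
    exact mul_le_mul (h t ht x hx) (h' t ht x hx) (abs_nonneg _) hC
  lipschitz := by
    obtain ⟨C, hC, b⟩ := hF.bounded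
    obtain ⟨C', hC', b'⟩ := hG.bounded
    obtain ⟨K, hK, h⟩ := hF.lipschitz
    obtain ⟨K', hK', h'⟩ := hG.lipschitz
    refine ⟨C * K' + K * C', by positivity, fun t ht x hx y hy => ?_⟩
    calc |F t x * G t x - F t y * G t y|
        = |F t x * (G t x - G t y) + (F t x - F t y) * G t y| := by ring_nf
      _ ≤ |F t x| * |G t x - G t y| + |F t x - F t y| * |G t y| := by
          simpa only [abs_mul] using
            abs_add_le (F t x * (G t x - G t y)) ((F t x - F t y) * G t y)
      _ ≤ C * (K' * ‖x - y‖) + K * ‖x - y‖ * C' := by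
          gcongr
          · exact b t ht x hx
          · exact h' t ht x hx y hy
          · exact h t ht x hx y hy
          · exact b' t ht y hy
      _ = (C * K' + K * C') * ‖x - y‖ := by ring
  continuousOn := hF.continuousOn.mul hG.continuousOn

theorem sub (hF : IsRegularField T S F) (hG : IsRegularField T S G) :
    IsRegularField T S (fun t x => F t x - G t x) := by
  simpa only [neg_one_mul, ← sub_eq_add_neg] using hF.add ((const (-1)).mul hG)

theorem sum {ι : Type*} {s : Finset ι} {F : ι → ℝ → E → ℝ}
    (hF : ∀ i ∈ s, IsRegularField T S (F i)) :
    IsRegularField T S (fun t x => ∑ i ∈ s, F i t x) := by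
  classical
  induction s using Finset.induction_on with
  | empty => simpa using const 0
  | insert i s hi ih =>
    simp only [Finset.sum_insert hi]
    exact (hF i (Finset.mem_insert_self _ _)).add
      (ih fun k hk => hF k (Finset.mem_insert_of_mem hk))

theorem comp₂ {Φ : ℝ → ℝ → ℝ} {K : ℝ} (hK : 0 < K)
    (hb : ∀ u ∈ Icc (0:ℝ) 1, ∀ w ∈ Icc (0:ℝ) 1, Φ u w ∈ Icc (0:ℝ) 1)
    (hL : ∀ u₁ ∈ Icc (0:ℝ) 1, ∀ w₁ ∈ Icc (0:ℝ) 1, ∀ u₂ ∈ Icc (0:ℝ) 1,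
      ∀ w₂ ∈ Icc (0:ℝ) 1, |Φ u₂ w₂ - Φ u₁ w₁| ≤ K * (|u₂ - u₁| + |w₂ - w₁|))
    (hF : IsRegularField T S F) (hG : IsRegularField T S G)
    (hF' : ∀ t ∈ Icc (0:ℝ) T, ∀ x ∈ S, F t x ∈ Icc (0:ℝ) 1)
    (hG' : ∀ t ∈ Icc (0:ℝ) T, ∀ x ∈ S, G t x ∈ Icc (0:ℝ) 1) :
    IsRegularField T S (fun t x => Φ (F t x) (G t x)) where
  bounded := ⟨1, zero_le_one, fun t ht x hx => by
    have := hb _ (hF' t ht x hx) _ (hG' t ht x hx)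
    rw [abs_of_nonneg this.1]
    exact this.2⟩
  lipschitz := by
    obtain ⟨K₁, hK₁, h₁⟩ := hF.lipschitz
    obtain ⟨K₂, hK₂, h₂⟩ := hG.lipschitz
    refine ⟨K * (K₁ + K₂), by positivity, fun t ht x hx y hy => ?_⟩
    refine (hL _ (hF' t ht y hy) _ (hG' t ht y hy) _ (hF' t ht x hx) _ (hG' t ht x hx)).trans ?_
    rw [mul_assoc, add_mul]
    gcongr
    · exact h₁ t ht x hx y hy
    · exact h₂ t ht x hx y hy
  continuousOn := by
    intro p hp
    have hlim : Filter.Tendsto (fun q : ℝ × E =>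
        K * (|F q.1 q.2 - F p.1 p.2| + |G q.1 q.2 - G p.1 p.2|))
        (nhdsWithin p (Icc 0 T ×ˢ S)) (nhds 0) := by
      have h₁ := ((hF.continuousOn p hp).sub
        (continuousWithinAt_const (b := F p.1 p.2))).abs
      have h₂ := ((hG.continuousOn p hp).sub
        (continuousWithinAt_const (b := G p.1 p.2))).abs
      simpa [ContinuousWithinAt] using (h₁.add h₂).const_mul K
    refine tendsto_iff_dist_tendsto_zero.2 (squeeze_zero' ?_ ?_ hlim)
    · exact Filter.Eventually.of_forall fun _ => dist_nonneg
    · filter_upwards [self_mem_nhdsWithin] with q hq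
      exact hL _ (hF' _ hp.1 _ hp.2) _ (hG' _ hp.1 _ hp.2) _ (hF' _ hq.1 _ hq.2) _
        (hG' _ hq.1 _ hq.2)

theorem flux {Φ : ℝ → ℝ → ℝ} (hΦ : IsFluxLimiter Φ)
    (hF : IsRegularField T S F) (hG : IsRegularField T S G)
    (hF' : ∀ t ∈ Icc (0:ℝ) T, ∀ x ∈ S, F t x ∈ Icc (0:ℝ) 1)
    (hG' : ∀ t ∈ Icc (0:ℝ) T, ∀ x ∈ S, G t x ∈ Icc (0:ℝ) 1) :
    IsRegularField T S (fun t x => Φ (F t x) (G t x)) := by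
  obtain ⟨hb, -, K, hK, hL⟩ := hΦ
  exact comp₂ hK hb hL hF hG hF' hG'

end IsRegularField

theorem rhoF_mem_Icc {n : ℕ} {f : Fin n → ℝ} (hf : admissibleF f) : rhoF f ∈ Icc (0:ℝ) 1 :=
  ⟨Finset.sum_nonneg fun j _ => (hf.1 j).1, hf.2⟩

theorem mul_sum_deltaC_mem_Icc {n : ℕ} {f : Fin n → ℝ} (hf : admissibleF f) {c : ℝ}
    (hc : c ∈ Icc (0:ℝ) 1) : c * ∑ k, deltaC k * f k ∈ Icc (0:ℝ) 1 := by
  have hδ : ∀ k : Fin n, 0 ≤ deltaC k * f k ∧ deltaC k * f k ≤ f k := fun k => by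
    have := (hf.1 k).1
    unfold deltaC
    split_ifs <;> simp [this]
  have h0 : 0 ≤ ∑ k, deltaC k * f k := Finset.sum_nonneg fun k _ => (hδ k).1
  have h1 : ∑ k, deltaC k * f k ≤ 1 := (Finset.sum_le_sum fun k _ => (hδ k).2).trans hf.2
  exact ⟨mul_nonneg hc.1 h0, mul_le_one₀ hc.2 h0 h1⟩

namespace IsRegularField

variable {E : Type*} [NormedAddCommGroup E] {T : ℝ} {S : Set E} {n : ℕ}
  {f f1 f2 f3 : E → Fin n → ℝ}

theorem rho (hf : ∀ j, IsRegularField T S (fun _ x => f x j)) :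
    IsRegularField T S (fun _ x => rhoF (f x)) :=
  sum fun j _ => hf j

/-- The balance of gain and loss by interactions is a regular field. -/
theorem interaction (η0 : ℝ) {A : Fin n → Fin n → Fin n → ℝ → ℝ} (hA : IsTableOfGames A)
    (hf : ∀ j, IsRegularField T S (fun _ x => f x j)) (hS : ∀ x ∈ S, admissibleF (f x))
    (j : Fin n) :
    IsRegularField T S (fun _ x => gainF η0 A j (f x) - f x j * lossF η0 (f x)) := by
  have hρ := rho hf
  have hA' : ∀ h k, IsRegularField T S (fun _ x => A h k j (rhoF (f x))) := fun h k => by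
    obtain ⟨K, hK, hL⟩ := hA.2.2 h k j
    refine comp₂ (Φ := fun u _ => A h k j u) hK (fun u hu _ _ => hA.1 h k j u hu)
      (fun u₁ hu₁ w₁ _ u₂ hu₂ w₂ _ => (hL u₂ hu₂ u₁ hu₁).trans ?_) hρ hρ
      (fun _ _ x hx => rhoF_mem_Icc (hS x hx)) (fun _ _ x hx => rhoF_mem_Icc (hS x hx))
    gcongr
    exact le_add_of_nonneg_right (abs_nonneg _)
  have hgain : IsRegularField T S (fun _ x => gainF η0 A j (f x)) :=
    ((const η0).mul hρ).mul (sum fun h _ => sum fun k _ => ((hA' h k).mul (hf h)).mul (hf k))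
  have hloss : IsRegularField T S (fun _ x => lossF η0 (f x)) := by
    simpa only [lossF, sq] using (const η0).mul (hρ.mul hρ)
  exact hgain.sub ((hf j).mul hloss)

theorem junction_flux {Φ : ℝ → ℝ → ℝ} (hΦ : IsFluxLimiter Φ) {c : ℝ} (hc : c ∈ Icc (0:ℝ) 1)
    (hf1 : ∀ j, IsRegularField T S (fun _ x => f1 x j)) (hS1 : ∀ x ∈ S, admissibleF (f1 x))
    (hf : ∀ j, IsRegularField T S (fun _ x => f x j)) (hS : ∀ x ∈ S, admissibleF (f x)) :
    IsRegularField T S (fun _ x => c * Φ (c * ∑ k, deltaC k * f1 x k) (rhoF (f x))) :=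
  (const c).mul (flux hΦ ((const c).mul (sum fun k _ => (const (deltaC k)).mul (hf1 k)))
    (rho hf) (fun _ _ x hx => mul_sum_deltaC_mem_Icc (hS1 x hx) hc)
    (fun _ _ x hx => rhoF_mem_Icc (hS x hx)))

/-- The right-hand side on a road leaving the junction is a regular field. -/
theorem outgoing {Φ : ℝ → ℝ → ℝ} (hΦ : IsFluxLimiter Φ) {c : ℝ} (hc : c ∈ Icc (0:ℝ) 1)
    (v : Fin n → ℝ) (η0 : ℝ) {A : Fin n → Fin n → Fin n → ℝ → ℝ} (hA : IsTableOfGames A)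
    {Φbar : ℝ → ℝ} (hΦbar : ContinuousOn Φbar (Icc 0 T))
    (hf1 : ∀ j, IsRegularField T S (fun _ x => f1 x j)) (hS1 : ∀ x ∈ S, admissibleF (f1 x))
    (hf : ∀ j, IsRegularField T S (fun _ x => f x j)) (hS : ∀ x ∈ S, admissibleF (f x))
    (j : Fin n) :
    IsRegularField T S
      (fun t x => rhs2 v η0 A Φ c Φbar (fun _ => f1 x) (fun _ => f x) j t) := by
  simp only [rhs2, add_sub_assoc]
  exact ((const (v j)).mul ((((junction_flux hΦ hc hf1 hS1 hf hS).mul (hf1 j)).mul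
    (const (deltaC j))).sub ((of_time hΦbar).mul (hf j)))).add (interaction η0 hA hf hS j)

/-- The right-hand side on the road entering the junction is a regular field. -/
theorem incoming {Φ : ℝ → ℝ → ℝ} (hΦ : IsFluxLimiter Φ) {a : ℝ} (ha : a ∈ Icc (0:ℝ) 1)
    (v : Fin n → ℝ) (η0 : ℝ) {A : Fin n → Fin n → Fin n → ℝ → ℝ} (hA : IsTableOfGames A)
    {fbar1 : ℝ → Fin n → ℝ} (hfbar : ContinuousOn fbar1 (Icc 0 T))
    (hfbar' : ∀ t ∈ Icc (0:ℝ) T, admissibleF (fbar1 t))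
    (hf1 : ∀ j, IsRegularField T S (fun _ x => f1 x j)) (hS1 : ∀ x ∈ S, admissibleF (f1 x))
    (hf2 : ∀ j, IsRegularField T S (fun _ x => f2 x j)) (hS2 : ∀ x ∈ S, admissibleF (f2 x))
    (hf3 : ∀ j, IsRegularField T S (fun _ x => f3 x j)) (hS3 : ∀ x ∈ S, admissibleF (f3 x))
    (j : Fin n) :
    IsRegularField T S (fun t x =>
      rhs1 v η0 A Φ a fbar1 (fun _ => f1 x) (fun _ => f2 x) (fun _ => f3 x) j t) := by
  have hb : ∀ k, IsRegularField T S (fun t _ => fbar1 t k) := fun k =>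
    of_time (continuousOn_pi.1 hfbar k)
  have ha' : 1 - a ∈ Icc (0:ℝ) 1 := ⟨sub_nonneg.2 ha.2, sub_le_self _ ha.1⟩
  have hin : IsRegularField T S (fun t x => Φ (∑ k, fbar1 t k) (rhoF (f1 x))) :=
    flux hΦ (sum fun k _ => hb k) (rho hf1) (fun t ht _ _ => rhoF_mem_Icc (hfbar' t ht))
      (fun _ _ x hx => rhoF_mem_Icc (hS1 x hx))
  simp only [rhs1, add_sub_assoc]
  exact ((const (v j)).mul ((hin.mul (hb j)).sub (((junction_flux hΦ ha hf1 hS1 hf2 hS2).add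
    (junction_flux hΦ ha' hf1 hS1 hf3 hS3)).mul (hf1 j)))).add (interaction η0 hA hf1 hS1 j)

end IsRegularField

/-- A function satisfying the integral form of an equation with continuous
right-hand side has that right-hand side as right derivative. -/
theorem hasDerivWithinAt_Ici_of_eq_integral {T c : ℝ} {y r : ℝ → ℝ}
    (hr : ContinuousOn r (Icc 0 T)) (hy : ∀ t ∈ Icc 0 T, y t = c + ∫ s in (0:ℝ)..t, r s)
    {t : ℝ} (ht : t ∈ Ico 0 T) : HasDerivWithinAt y (r t) (Ici t) t := by
  have htT : t ∈ Icc 0 T := Ico_subset_Icc_self ht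
  have hmem : Icc 0 T ∈ nhdsWithin t (Ici t) :=
    Filter.mem_of_superset (Icc_mem_nhdsGE ht.2) (Icc_subset_Icc_left ht.1)
  have hmem' : Icc 0 T ∈ nhdsWithin t (Ioi t) := nhdsWithin_mono t Ioi_subset_Ici_self hmem
  have hint : IntervalIntegrable r MeasureTheory.volume 0 t :=
    (hr.mono (Icc_subset_Icc_right ht.2.le)).intervalIntegrable_of_Icc ht.1
  have hmeas : StronglyMeasurableAtFilter r (nhdsWithin t (Ioi t)) :=
    ⟨Icc 0 T, hmem', hr.aestronglyMeasurable measurableSet_Icc⟩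
  have hderiv := (intervalIntegral.integral_hasDerivWithinAt_right (s := Ici t) hint hmeas
    ((hr t htT).mono_of_mem_nhdsWithin hmem')).const_add c
  exact hderiv.congr_of_eventuallyEq (Filter.eventuallyEq_of_mem hmem hy) (hy t htT)

theorem eqOn_of_isRegularField_of_eq_integral {ι : Type*} [Fintype ι] {T : ℝ}
    {S : Set (ι → ℝ)} {F : ι → ℝ → (ι → ℝ) → ℝ} (hF : ∀ i, IsRegularField T S (F i))
    {c : ι → ℝ} {y z : ℝ → ι → ℝ} (hy : ContinuousOn y (Icc 0 T))
    (hz : ContinuousOn z (Icc 0 T)) (hyS : ∀ t ∈ Icc 0 T, y t ∈ S) (hzS : ∀ t ∈ Icc 0 T, z t ∈ S)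
    (hyi : ∀ t ∈ Icc 0 T, ∀ i, y t i = c i + ∫ s in (0:ℝ)..t, F i s (y s))
    (hzi : ∀ t ∈ Icc 0 T, ∀ i, z t i = c i + ∫ s in (0:ℝ)..t, F i s (z s)) :
    EqOn y z (Icc 0 T) := by
  choose K hK hL using fun i => (hF i).lipschitz
  have hlip : ∀ t ∈ Ico 0 T, LipschitzOnWith (∑ i, K i).toNNReal (fun x i => F i t x) S := by
    intro t ht
    refine LipschitzOnWith.of_dist_le_mul fun x hx x' hx' => ?_
    have h0 : 0 ≤ ∑ i, K i := Finset.sum_nonneg fun i _ => hK i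
    rw [Real.coe_toNNReal _ h0, dist_pi_le_iff (by positivity)]
    intro i
    rw [dist_eq_norm x x']
    refine (hL i t (Ico_subset_Icc_self ht) x hx x' hx').trans ?_
    gcongr
    exact Finset.single_le_sum (fun i _ => hK i) (Finset.mem_univ i)
  have hderiv : ∀ w : ℝ → ι → ℝ, ContinuousOn w (Icc 0 T) → (∀ t ∈ Icc 0 T, w t ∈ S) →
      (∀ t ∈ Icc 0 T, ∀ i, w t i = c i + ∫ s in (0:ℝ)..t, F i s (w s)) →
      ∀ t ∈ Ico 0 T, HasDerivWithinAt w (fun i => F i t (w t)) (Ici t) t := by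
    intro w hw hwS hwi t ht
    refine hasDerivWithinAt_pi.2 fun i => ?_
    refine hasDerivWithinAt_Ici_of_eq_integral (r := fun s => F i s (w s)) ?_
      (fun t ht => hwi t ht i) ht
    exact (hF i).continuousOn.comp (continuousOn_id.prodMk hw) fun s hs => ⟨hs, hwS s hs⟩
  intro t ht
  have h0 : (0:ℝ) ∈ Icc 0 T := ⟨le_rfl, ht.1.trans ht.2⟩
  refine ODE_solution_unique_of_mem_Icc_right (v := fun t x i => F i t x) (s := fun _ => S) hlip
    hy (hderiv y hy hyS hyi) (fun t ht => hyS t (Ico_subset_Icc_self ht))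
    hz (hderiv z hz hzS hzi) (fun t ht => hzS t (Ico_subset_Icc_self ht)) ?_ ht
  funext i
  simp [hyi 0 h0, hzi 0 h0]

/-- Uniqueness of the mild kinetic solution across the 1-2 junction. -/
theorem uniqueness_one_two_junction
    {n : ℕ} (hn : 2 ≤ n) (v : Fin n → ℝ) (hv : IsSpeedLattice hn v)
    (η0 : ℝ) (hη0 : 0 < η0)
    (A : Fin n → Fin n → Fin n → ℝ → ℝ) (hA : IsTableOfGames A)
    (Φ : ℝ → ℝ → ℝ) (hΦ : IsFluxLimiter Φ)
    (a T : ℝ) (ha : a ∈ Icc (0:ℝ) 1) (hT : 0 < T)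
    (φ1 φ2 φ3 : Fin n → ℝ) (fbar1 : ℝ → Fin n → ℝ) (Φbar2 Φbar3 : ℝ → ℝ)
    (hdata : GoodData12 T φ1 φ2 φ3 fbar1 Φbar2 Φbar3)
    (f1 f2 f3 g1 g2 g3 : ℝ → Fin n → ℝ)
    (hF : IsMildSol12 v η0 A Φ a T φ1 φ2 φ3 fbar1 Φbar2 Φbar3 f1 f2 f3)
    (hG : IsMildSol12 v η0 A Φ a T φ1 φ2 φ3 fbar1 Φbar2 Φbar3 g1 g2 g3) :
    ∀ t ∈ Icc (0:ℝ) T, ∀ j : Fin n, f1 t j = g1 t j ∧ f2 t j = g2 t j ∧ f3 t j = g3 t j := by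
  obtain ⟨-, -, -, hb, hb', hb2, -, hb3, -⟩ := hdata
  have ha' : 1 - a ∈ Icc (0:ℝ) 1 := ⟨sub_nonneg.2 ha.2, sub_le_self _ ha.1⟩
  let road : Fin 3 → (Fin 3 × Fin n → ℝ) → Fin n → ℝ := fun r x j => x (r, j)
  let S : Set (Fin 3 × Fin n → ℝ) := {x | ∀ r, admissibleF (road r x)}
  have hS : ∀ r, ∀ x ∈ S, admissibleF (road r x) := fun r x hx => hx r
  have hroad : ∀ r j, IsRegularField T S (fun _ x => road r x j) := fun r j =>
    IsRegularField.of_clm (ContinuousLinearMap.proj (R := ℝ) (φ := fun _ => ℝ) (r, j))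
      zero_le_one fun x hx =>
        (abs_of_nonneg ((hS r x hx).1 j).1).trans_le ((hS r x hx).1 j).2
  let V : Fin 3 → Fin n → ℝ → (Fin 3 × Fin n → ℝ) → ℝ := ![
    fun j t x => rhs1 v η0 A Φ a fbar1 (fun _ => road 0 x) (fun _ => road 1 x)
      (fun _ => road 2 x) j t,
    fun j t x => rhs2 v η0 A Φ a Φbar2 (fun _ => road 0 x) (fun _ => road 1 x) j t,
    fun j t x => rhs2 v η0 A Φ (1 - a) Φbar3 (fun _ => road 0 x) (fun _ => road 2 x) j t]
  have hV : ∀ i : Fin 3 × Fin n, IsRegularField T S (V i.1 i.2) := by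
    rintro ⟨r, j⟩
    fin_cases r
    · exact IsRegularField.incoming hΦ ha v η0 hA hb hb' (hroad 0) (hS 0) (hroad 1) (hS 1)
        (hroad 2) (hS 2) j
    · exact IsRegularField.outgoing hΦ ha v η0 hA hb2 (hroad 0) (hS 0) (hroad 1) (hS 1) j
    · exact IsRegularField.outgoing hΦ ha' v η0 hA hb3 (hroad 0) (hS 0) (hroad 2) (hS 2) j
  let state : (ℝ → Fin n → ℝ) → (ℝ → Fin n → ℝ) → (ℝ → Fin n → ℝ) → ℝ → Fin 3 × Fin n → ℝ :=
    fun p1 p2 p3 t i => (![p1 t, p2 t, p3 t] : Fin 3 → Fin n → ℝ) i.1 i.2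
  have hstate : ∀ p1 p2 p3, IsMildSol12 v η0 A Φ a T φ1 φ2 φ3 fbar1 Φbar2 Φbar3 p1 p2 p3 →
      ContinuousOn (state p1 p2 p3) (Icc 0 T) ∧ (∀ t ∈ Icc 0 T, state p1 p2 p3 t ∈ S) ∧
      ∀ t ∈ Icc 0 T, ∀ i : Fin 3 × Fin n, state p1 p2 p3 t i =
        (![φ1, φ2, φ3] : Fin 3 → Fin n → ℝ) i.1 i.2 +
          ∫ s in (0:ℝ)..t, V i.1 i.2 s (state p1 p2 p3 s) := by
    rintro p1 p2 p3 ⟨hc1, hc2, hc3, hadm, h1, h2, h3⟩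
    refine ⟨continuousOn_pi.2 ?_, fun t ht r => ?_, fun t ht => ?_⟩
    · rintro ⟨r, j⟩
      fin_cases r
      · exact continuousOn_pi.1 hc1 j
      · exact continuousOn_pi.1 hc2 j
      · exact continuousOn_pi.1 hc3 j
    · fin_cases r
      · exact (hadm t ht).1
      · exact (hadm t ht).2.1
      · exact (hadm t ht).2.2
    · rintro ⟨r, j⟩
      fin_cases r
      · exact h1 t ht j
      · exact h2 t ht j
      · exact h3 t ht j
  obtain ⟨hFc, hFS, hFi⟩ := hstate f1 f2 f3 hF
  obtain ⟨hGc, hGS, hGi⟩ := hstate g1 g2 g3 hG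
  intro t ht j
  have heq := eqOn_of_isRegularField_of_eq_integral
    (c := fun i => (![φ1, φ2, φ3] : Fin 3 → Fin n → ℝ) i.1 i.2) hV hFc hGc hFS hGS hFi hGi ht
  exact ⟨congrFun heq (0, j), congrFun heq (1, j), congrFun heq (2, j)⟩
end
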